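/- Let (K, δ) be a differential field of characteristic zero with field of constants C, and let L(y) = Σ_{i=0}^n a_i δ^i(y) be a linear differential operator of order n over K (i.e. a_0,…,a_n ∈ K with a_n ≠ 0). Assume that for every integer m with 0 ≤ m < n and all c_0,…,c_m ∈ K with c_m ≠ 0, there exists b ∈ K such that L(b) = 0 and Σ_{j=0}^m c_j δ^j(b) ≠ 0. Then the solution set {y ∈ K : L(y) = 0} is a C-subspace of K of dimension exactly n (i.e. L admits a fundamental set of solutions inside K). -/

import Mathlib

/-- If no nonzero operator of order less than `n` kills all of `S`, then the jets
`(b, δ b, …, δ^[n-1] b)` of the elements `b ∈ S` span `K ^ n`. -/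
theorem span_jets_eq_top {K : Type*} [Field K] (δ : K → K) (n : ℕ) (S : Set K)
    (hS : ∀ m : ℕ, m < n → ∀ c : Fin (m + 1) → K, c (Fin.last m) ≠ 0 →
      ∃ b ∈ S, (∑ j : Fin (m + 1), c j * δ^[(j : ℕ)] b) ≠ 0) :
    Submodule.span K ((fun b (j : Fin n) => δ^[(j : ℕ)] b) '' S) = ⊤ := by
  classical
  by_contra hne
  obtain ⟨f, hf, hle⟩ := Submodule.exists_le_ker_of_lt_top _ (lt_top_iff_ne_top.2 hne)
  set c : Fin n → K := fun j => f (Pi.single j 1) with hc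
  have hfc : ∀ v, f v = ∑ j, c j * v j := fun v => by
    rw [LinearMap.pi_apply_eq_sum_univ f v]
    refine Finset.sum_congr rfl fun j _ => ?_
    rw [smul_eq_mul, mul_comm, hc]
    congr 2
    ext k
    simp [Pi.single_apply, eq_comm]
  have hex : (Finset.univ.filter fun j => c j ≠ 0).Nonempty := by
    by_contra h
    apply hf
    refine LinearMap.ext fun v => ?_
    simp only [Finset.not_nonempty_iff_eq_empty, Finset.filter_eq_empty_iff, not_not] at h
    simp [hfc, h]
  obtain ⟨m, hm, hmax⟩ := Finset.exists_max_image _ id hex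
  obtain ⟨b, hb, hne'⟩ := hS m m.2 (fun j => c ⟨j, by omega⟩) (by simpa using hm)
  apply hne'
  have h0 : f (fun j : Fin n => δ^[(j : ℕ)] b) = 0 :=
    hle (Submodule.subset_span ⟨b, hb, rfl⟩)
  rw [hfc] at h0
  rw [← h0]
  refine Finset.sum_of_injOn (fun j : Fin (m + 1) => (⟨j, by omega⟩ : Fin n)) ?_ ?_ ?_ ?_
  · intro i _ j _ h
    simpa [Fin.ext_iff] using h
  · simp [Set.MapsTo]
  · intro i _ hi
    have : c i = 0 := by
      by_contra h
      have hle' : i ≤ m := hmax i (by simpa using h)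
      exact hi ⟨⟨i, Nat.lt_succ_of_le hle'⟩, by simp, rfl⟩
    simp [this]
  · simp


/-- Let `(K, δ)` be a differential field of characteristic zero and
`L(y) = Σ_{i=0}^n a_i δ^i(y)` a linear differential operator of order `n` over `K`.
If for every `m < n` and every nonzero tuple `c_0, …, c_m ∈ K` (with `c_m ≠ 0`) there is
`b ∈ K` with `L(b) = 0` and `Σ_j c_j δ^j(b) ≠ 0`, then the solution set
`{y ∈ K : L(y) = 0}` is a vector space over the constants of dimension exactly `n`,
i.e. `L` has a fundamental set of `n` solutions inside `K`. -/
theorem stmt_1 {K : Type*} [Field K] [CharZero K]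
    (δ : K → K)
    (hδadd : ∀ x y : K, δ (x + y) = δ x + δ y)
    (hδmul : ∀ x y : K, δ (x * y) = x * δ y + y * δ x)
    (n : ℕ) (a : Fin (n + 1) → K) (han : a (Fin.last n) ≠ 0)
    (hyp : ∀ m : ℕ, m < n → ∀ c : Fin (m + 1) → K, c (Fin.last m) ≠ 0 →
      ∃ b : K, (∑ i : Fin (n + 1), a i * δ^[(i : ℕ)] b) = 0 ∧
        (∑ j : Fin (m + 1), c j * δ^[(j : ℕ)] b) ≠ 0) :
    ∃ y : Fin n → K,
      (∀ i, (∑ j : Fin (n + 1), a j * δ^[(j : ℕ)] (y i)) = 0) ∧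
      (∀ c : Fin n → K, (∀ i, δ (c i) = 0) →
        (∑ i, c i * y i) = 0 → ∀ i, c i = 0) ∧
      (∀ z : K, (∑ j : Fin (n + 1), a j * δ^[(j : ℕ)] z) = 0 →
        ∃ c : Fin n → K, (∀ i, δ (c i) = 0) ∧ z = ∑ i, c i * y i) := by
  have hδ0 : δ 0 = 0 := by simpa using hδadd 0 0
  have hδsum : ∀ f : Fin n → K, δ (∑ i, f i) = ∑ i, δ (f i) := fun f =>
    map_sum (AddMonoidHom.mk' δ hδadd) f Finset.univ
  set S : Set K := {b | (∑ j : Fin (n + 1), a j * δ^[(j : ℕ)] b) = 0} with hS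
  have hspan := span_jets_eq_top δ n S hyp
  obtain ⟨f, hfS, hfspan, hfli⟩ := Submodule.exists_fun_fin_finrank_span_eq K
    ((fun b (j : Fin n) => δ^[(j : ℕ)] b) '' S)
  have hrank : Module.finrank K (Submodule.span K
      ((fun b (j : Fin n) => δ^[(j : ℕ)] b) '' S)) = n := by
    rw [hspan, finrank_top, Module.finrank_fin_fun]
  replace hfspan := hfspan.trans hspan
  generalize Module.finrank K (Submodule.span K
      ((fun b (j : Fin n) => δ^[(j : ℕ)] b) '' S)) = d at f hfS hfspan hfli hrank
  subst hrank
  choose y hyS hyf using hfS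
  have hli : ∀ g : Fin d → K, (∀ j : Fin d, ∑ i, g i * δ^[(j : ℕ)] (y i) = 0) →
      ∀ i, g i = 0 := fun g hg =>
    Fintype.linearIndependent_iff.1 hfli g (by
      ext j
      simpa [← hyf] using hg j)
  refine ⟨y, hyS, fun c hc h0 => hli c fun j => ?_, fun z hz => ?_⟩
  · generalize (j : ℕ) = j
    induction j with
    | zero => simpa using h0
    | succ k ih =>
      have h := congrArg δ ih
      simpa [hδsum, hδmul, hδ0, hc, Function.iterate_succ_apply'] using h
  · have hztop : (fun j : Fin d => δ^[(j : ℕ)] z) ∈ Submodule.span K (Set.range f) := by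
      rw [hfspan]; trivial
    obtain ⟨c, hcz⟩ := (Submodule.mem_span_range_iff_exists_fun K).1 hztop
    have hlow : ∀ j < d, δ^[j] z = ∑ i, c i * δ^[j] (y i) := fun j hj => by
      simpa [← hyf] using (congrFun hcz ⟨j, hj⟩).symm
    have htop : δ^[d] z = ∑ i, c i * δ^[d] (y i) := by
      have hsol : ∀ b ∈ S, a (Fin.last d) * δ^[d] b =
          -∑ j : Fin d, a j.castSucc * δ^[(j : ℕ)] b := fun b hb => by
        rw [hS, Set.mem_ofPred_eq, Fin.sum_univ_castSucc] at hb
        simpa using eq_neg_of_add_eq_zero_right hb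
      apply mul_left_cancel₀ han
      rw [hsol z hz, Finset.mul_sum]
      simp_rw [mul_left_comm (a (Fin.last d)), hsol _ (hyS _)]
      simp_rw [mul_neg, Finset.sum_neg_distrib, Finset.mul_sum]
      rw [Finset.sum_comm]
      congr 1
      refine Finset.sum_congr rfl fun j _ => ?_
      rw [hlow j j.2, Finset.mul_sum]
      exact Finset.sum_congr rfl fun i _ => mul_left_comm _ _ _
    have hall : ∀ j ≤ d, δ^[j] z = ∑ i, c i * δ^[j] (y i) := fun j hj =>
      hj.lt_or_eq.elim (hlow j) (by rintro rfl; exact htop)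
    refine ⟨c, hli (fun i => δ (c i)) fun j => ?_, by simpa using hall 0 d.zero_le⟩
    have h := congrArg δ (hall j j.2.le)
    rw [← Function.iterate_succ_apply' δ, hall _ j.2, hδsum] at h
    simp_rw [hδmul, Finset.sum_add_distrib, Function.iterate_succ_apply'] at h
    simpa [mul_comm] using h
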